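/- arXiv:1503.00766 — 2 statements merged into one kernel-verified Lean document; each statement's English description precedes it below -/
import Mathlib

section
/- For every roll-off parameter α ∈ (0, 1/3) and every t ∈ ℝ with t ≠ 0, (4αt)² ≠ 1 and (8αt)² ≠ 1, the imaginary part of the inverse Fourier transform s_α(t) := (1/(2π))·∫_{ℝ} S_α(w)·e^{iwt} dw of the de Oliveira shaping pulse satisfies √(2π)·Im(s_α(t)) = (1/(2πt))·( cos(π(1+α)t) − cos(2π(1−α)t) ) + (2α/π)·( sin(π(1−α)t) + 4αt·cos(π(1+α)t) )/(1 − (4αt)²) + (4α/π)·( sin(2π(1+α)t) − 8αt·cos(2π(1−α)t) )/(1 − (8αt)²). -/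
/-- The shaping pulse `S_α` of the de Oliveira wavelet, for roll-off parameter `α`. -/
noncomputable def deOliveiraShape (α w : ℝ) : ℝ :=
  if w < (1 - α) * Real.pi then 0
  else if w < (1 + α) * Real.pi then
    (1 / Real.sqrt (2 * Real.pi)) * Real.cos ((w - (1 + α) * Real.pi) / (4 * α))
  else if w < 2 * Real.pi * (1 - α) then 1 / Real.sqrt (2 * Real.pi)
  else if w < 2 * Real.pi * (1 + α) then
    (1 / Real.sqrt (2 * Real.pi)) * Real.cos ((w - 2 * Real.pi * (1 - α)) / (8 * α))
  else 0

open MeasureTheory in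
lemma aux_add (f g h : ℝ → ℂ) (hf : Integrable f) (hg : Integrable g) (hh : Integrable h) :
    ∫ w, (f w + g w + h w) = (∫ w, f w) + (∫ w, g w) + ∫ w, h w := by
  have hfg : Integrable (fun w => f w + g w) := hf.add hg
  rw [integral_add hfg hh, integral_add hf hg]

open MeasureTheory in
lemma aux_piece (r : ℝ → ℝ) (hr : Continuous r) (t a b : ℝ) (hab : a ≤ b) :
    Integrable ((Set.Ico a b).indicator
      (fun w : ℝ => ((r w : ℝ) : ℂ) * Complex.exp (Complex.I * w * t))) ∧
    (∫ w : ℝ, (Set.Ico a b).indicator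
      (fun w : ℝ => ((r w : ℝ) : ℂ) * Complex.exp (Complex.I * w * t)) w).im
      = ∫ w in a..b, r w * Real.sin (w * t) := by
  have hc : Continuous (fun w : ℝ => ((r w : ℝ) : ℂ) * Complex.exp (Complex.I * w * t)) := by
    fun_prop
  constructor
  · rw [integrable_indicator_iff measurableSet_Ico]
    exact (hc.integrableOn_Icc).mono_set Set.Ico_subset_Icc_self
  · rw [integral_indicator measurableSet_Ico, integral_Ico_eq_integral_Ioc,
      ← intervalIntegral.integral_of_le hab]
    have h := Complex.imCLM.intervalIntegral_comp_comm (hc.intervalIntegrable (μ := volume) a b)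
    rw [← Complex.imCLM_apply, ← h]
    congr 1
    ext w
    have : Complex.I * w * t = ((w * t : ℝ) : ℂ) * Complex.I := by push_cast; ring
    rw [Complex.imCLM_apply, Complex.im_ofReal_mul, this, Complex.exp_ofReal_mul_I_im]

lemma aux_cos (m p t a b : ℝ) (hm : m ≠ 0) (h : (m * t) ^ 2 ≠ 1) :
    ∫ w in a..b, Real.cos ((w - p) / m) * Real.sin (w * t)
      = m / (1 - (m * t) ^ 2) *
        ((m * t * Real.cos ((b - p) / m) * Real.cos (b * t)
            + Real.sin ((b - p) / m) * Real.sin (b * t))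
        - (m * t * Real.cos ((a - p) / m) * Real.cos (a * t)
            + Real.sin ((a - p) / m) * Real.sin (a * t))) := by
  have h' : 1 - (m * t) ^ 2 ≠ 0 := fun h0 => h (by linarith)
  rw [mul_sub]
  refine intervalIntegral.integral_eq_sub_of_hasDerivAt
    (f := fun w => m / (1 - (m * t) ^ 2) * (m * t * Real.cos ((w - p) / m) * Real.cos (w * t)
            + Real.sin ((w - p) / m) * Real.sin (w * t))) (fun w _ => ?_)
    (Continuous.intervalIntegrable (by fun_prop) _ _)
  have e1 : HasDerivAt (fun w : ℝ => (w - p) / m) (1 / m) w :=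
    ((hasDerivAt_id w).sub_const p).div_const m
  have e2 : HasDerivAt (fun w : ℝ => w * t) (1 * t) w := (hasDerivAt_id w).mul_const t
  have := ((((e1.cos.const_mul (m * t)).mul e2.cos).add (e1.sin.mul e2.sin)).const_mul
    (m / (1 - (m * t) ^ 2)))
  refine this.congr_deriv ?_
  generalize Real.cos ((w - p) / m) = A
  generalize Real.sin ((w - p) / m) = B
  rw [div_mul_eq_mul_div, div_eq_iff h']
  field_simp
  ring

lemma aux_sin (t a b : ℝ) (ht : t ≠ 0) :
    ∫ w in a..b, Real.sin (w * t) = (Real.cos (a * t) - Real.cos (b * t)) / t := by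
  rw [intervalIntegral.integral_comp_mul_right _ ht, integral_sin, smul_eq_mul]
  ring

lemma aux_shape (α : ℝ) (hα : α ∈ Set.Ioo (0 : ℝ) (1 / 3)) (g : ℝ → ℂ) (w : ℝ) :
    ((deOliveiraShape α w : ℝ) : ℂ) * g w =
    (Set.Ico ((1 - α) * Real.pi) ((1 + α) * Real.pi)).indicator (fun w : ℝ =>
      (((1 / Real.sqrt (2 * Real.pi)) * Real.cos ((w - (1 + α) * Real.pi) / (4 * α)) : ℝ) : ℂ)
        * g w) w
    + (Set.Ico ((1 + α) * Real.pi) (2 * Real.pi * (1 - α))).indicator (fun w : ℝ =>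
      ((1 / Real.sqrt (2 * Real.pi) : ℝ) : ℂ) * g w) w
    + (Set.Ico (2 * Real.pi * (1 - α)) (2 * Real.pi * (1 + α))).indicator (fun w : ℝ =>
      (((1 / Real.sqrt (2 * Real.pi)) * Real.cos ((w - 2 * Real.pi * (1 - α)) / (8 * α)) : ℝ) : ℂ)
        * g w) w := by
  obtain ⟨h0, h3⟩ := hα
  have hp := Real.pi_pos
  have l1 : (1 - α) * Real.pi < (1 + α) * Real.pi := by nlinarith
  have l2 : (1 + α) * Real.pi < 2 * Real.pi * (1 - α) := by nlinarith
  have l3 : 2 * Real.pi * (1 - α) < 2 * Real.pi * (1 + α) := by nlinarith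
  unfold deOliveiraShape
  simp only [Set.indicator_apply, Set.mem_Ico]
  generalize (1 - α) * Real.pi = a at *
  generalize (1 + α) * Real.pi = b at *
  generalize 2 * Real.pi * (1 - α) = c at *
  generalize 2 * Real.pi * (1 + α) = d at *
  by_cases q1 : w < a
  · simp [q1, not_le.2 q1, not_le.2 (q1.trans l1), not_le.2 (q1.trans (l1.trans l2))]
  by_cases q2 : w < b
  · simp [q1, q2, not_lt.1 q1, not_le.2 q2, not_le.2 (q2.trans l2)]
  by_cases q3 : w < c
  · simp [q1, q2, q3, not_lt.1 q2, not_le.2 q3]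
  by_cases q4 : w < d
  · simp [q1, q2, q3, q4, not_lt.1 q3]
  · simp [q1, q2, q3, q4]

/-- For every roll-off parameter `α ∈ (0, 1/3)` and every `t ∈ ℝ` with `t ≠ 0`, `(4αt)² ≠ 1`
and `(8αt)² ≠ 1`, the imaginary part of the inverse Fourier transform
`s_α(t) = (1/(2π))·∫_{ℝ} S_α(w)·e^{iwt} dw` of the de Oliveira shaping pulse satisfies
`√(2π)·Im(s_α(t)) = (1/(2πt))·( cos(π(1+α)t) − cos(2π(1−α)t) )
  + (2α/π)·( sin(π(1−α)t) + 4αt·cos(π(1+α)t) )/(1 − (4αt)²)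
  + (4α/π)·( sin(2π(1+α)t) − 8αt·cos(2π(1−α)t) )/(1 − (8αt)²)`. -/
theorem deOliveira_wavelet_im (α : ℝ) (hα : α ∈ Set.Ioo (0 : ℝ) (1 / 3)) (t : ℝ) (ht : t ≠ 0)
    (h₁ : (4 * α * t) ^ 2 ≠ 1) (h₂ : (8 * α * t) ^ 2 ≠ 1) :
    Real.sqrt (2 * Real.pi) *
        ((1 / (2 * (Real.pi : ℂ))) *
          ∫ w : ℝ, ((deOliveiraShape α w : ℝ) : ℂ) * Complex.exp (Complex.I * w * t)).im
      = (1 / (2 * Real.pi * t))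
          * (Real.cos (Real.pi * (1 + α) * t) - Real.cos (2 * Real.pi * (1 - α) * t))
        + (2 * α / Real.pi)
          * (Real.sin (Real.pi * (1 - α) * t) + 4 * α * t * Real.cos (Real.pi * (1 + α) * t))
          / (1 - (4 * α * t) ^ 2)
        + (4 * α / Real.pi)
          * (Real.sin (2 * Real.pi * (1 + α) * t)
              - 8 * α * t * Real.cos (2 * Real.pi * (1 - α) * t))
          / (1 - (8 * α * t) ^ 2) := by
  have hα' := hα
  obtain ⟨h0, h3⟩ := hα'
  have hp := Real.pi_pos
  have l1 : (1 - α) * Real.pi < (1 + α) * Real.pi := by nlinarith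
  have l2 : (1 + α) * Real.pi < 2 * Real.pi * (1 - α) := by nlinarith
  have l3 : 2 * Real.pi * (1 - α) < 2 * Real.pi * (1 + α) := by nlinarith
  obtain ⟨i1, v1⟩ := aux_piece (fun w => (1 / Real.sqrt (2 * Real.pi)) *
    Real.cos ((w - (1 + α) * Real.pi) / (4 * α))) (by fun_prop) t _ _ l1.le
  obtain ⟨i2, v2⟩ := aux_piece (fun _ => 1 / Real.sqrt (2 * Real.pi)) (by fun_prop) t _ _ l2.le
  obtain ⟨i3, v3⟩ := aux_piece (fun w => (1 / Real.sqrt (2 * Real.pi)) *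
    Real.cos ((w - 2 * Real.pi * (1 - α)) / (8 * α))) (by fun_prop) t _ _ l3.le
  have hs : Real.sqrt (2 * Real.pi) ≠ 0 := (Real.sqrt_pos.2 (by positivity)).ne'
  have hpi : (1 / (2 * (Real.pi : ℂ))) = ((1 / (2 * Real.pi) : ℝ) : ℂ) := by push_cast; rfl
  rw [MeasureTheory.integral_congr_ae (Filter.Eventually.of_forall (fun w : ℝ =>
      aux_shape α hα (fun w : ℝ => Complex.exp (Complex.I * w * t)) w)),
    aux_add _ _ _ i1 i2 i3, hpi,
    Complex.im_ofReal_mul, Complex.add_im, Complex.add_im, v1, v2, v3]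
  simp only [mul_assoc (1 / Real.sqrt (2 * Real.pi)), intervalIntegral.integral_const_mul]
  rw [aux_cos (4 * α) _ t _ _ (by positivity) h₁, aux_cos (8 * α) _ t _ _ (by positivity) h₂,
    aux_sin t _ _ ht]
  have a1 : ((1 - α) * Real.pi - (1 + α) * Real.pi) / (4 * α) = -(Real.pi / 2) := by
    field_simp; ring
  have a2 : (2 * Real.pi * (1 + α) - 2 * Real.pi * (1 - α)) / (8 * α) = Real.pi / 2 := by
    field_simp; ring
  rw [a1, a2]
  simp only [sub_self, zero_div, Real.cos_zero, Real.sin_zero, Real.cos_neg, Real.sin_neg,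
    Real.cos_pi_div_two, Real.sin_pi_div_two]
  have k1 : 1 - (4 * α * t) ^ 2 ≠ 0 := fun h => h₁ (by linarith)
  have k2 : 1 - (8 * α * t) ^ 2 ≠ 0 := fun h => h₂ (by linarith)
  rw [mul_comm (1 + α) Real.pi, mul_comm (1 - α) Real.pi]
  generalize Real.sqrt (2 * Real.pi) = s at *
  generalize 1 - (4 * α * t) ^ 2 = K1 at *
  generalize 1 - (8 * α * t) ^ 2 = K2 at *
  generalize Real.cos (Real.pi * (1 + α) * t) = c1
  generalize Real.sin (Real.pi * (1 - α) * t) = c2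
  generalize Real.cos (2 * Real.pi * (1 - α) * t) = c3
  generalize Real.sin (2 * Real.pi * (1 + α) * t) = c4
  field_simp
  ring
end

section
/- (Corollary: generalised raised-cosine MRA) Let λ : (0,1) → ℝ be a nonnegative measurable function with ∫_0^1 λ(α) dα = 1 (a probability density). Then the scaling function spectrum Φ(w) := √( ∫_0^1 λ(α)·P_α(w) dα ), where P_α is the raised cosine spectrum with roll-off α, satisfies Meyer's central condition ∑_{n ∈ ℤ} Φ(w + 2πn)² = 1/(2π) for every w ∈ ℝ. -/
open MeasureTheory

/-- The raised cosine spectrum with roll-off parameter `α`. -/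
noncomputable def raisedCosine (α w : ℝ) : ℝ :=
  if |w| < (1 - α) * Real.pi then 1 / (2 * Real.pi)
  else if |w| < (1 + α) * Real.pi then
    (1 / (4 * Real.pi)) * (1 + Real.cos ((|w| - (1 - α) * Real.pi) / (2 * α)))
  else 0

lemma rc_nonneg (α w : ℝ) : 0 ≤ raisedCosine α w := by
  unfold raisedCosine
  have hp := Real.pi_pos
  split_ifs
  · positivity
  · have := Real.neg_one_le_cos ((|w| - (1 - α) * Real.pi) / (2 * α))
    exact mul_nonneg (by positivity) (by linarith)
  · exact le_rfl

lemma rc_le (α w : ℝ) : raisedCosine α w ≤ 1 / (2 * Real.pi) := by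
  unfold raisedCosine
  have hp := Real.pi_pos
  split_ifs
  · exact le_rfl
  · have := Real.cos_le_one ((|w| - (1 - α) * Real.pi) / (2 * α))
    calc _ ≤ (1 / (4 * Real.pi)) * 2 :=
          mul_le_mul_of_nonneg_left (by linarith) (by positivity)
      _ = _ := by field_simp; norm_num
  · positivity

lemma rc_meas (w : ℝ) : Measurable (fun α => raisedCosine α w) := by
  unfold raisedCosine
  refine Measurable.ite (measurableSet_lt (by fun_prop) (by fun_prop)) (by fun_prop) ?_
  refine Measurable.ite (measurableSet_lt (by fun_prop) (by fun_prop)) (by fun_prop) (by fun_prop)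

lemma rc_zero {α w : ℝ} (h0 : 0 < α) (h1 : α < 1) (hw : 2 * Real.pi ≤ |w|) :
    raisedCosine α w = 0 := by
  have hp := Real.pi_pos
  unfold raisedCosine
  rw [if_neg (by nlinarith), if_neg (by nlinarith)]

lemma rc_pair {α x : ℝ} (h0 : 0 < α) (h1 : α < 1) (hx0 : 0 ≤ x) (hx : x ≤ 2 * Real.pi) :
    raisedCosine α x + raisedCosine α (x - 2 * Real.pi) = 1 / (2 * Real.pi) := by
  have hp := Real.pi_pos
  have hap : 0 < α * Real.pi := by positivity
  unfold raisedCosine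
  rw [abs_of_nonneg hx0, abs_of_nonpos (by linarith : x - 2 * Real.pi ≤ 0)]
  have key : Real.cos ((-(x - 2 * Real.pi) - (1 - α) * Real.pi) / (2 * α))
      = - Real.cos ((x - (1 - α) * Real.pi) / (2 * α)) := by
    rw [← Real.cos_pi_sub]
    congr 1
    field_simp
    ring
  by_cases a1 : x < (1 - α) * Real.pi
  · rw [if_pos a1, if_neg (by nlinarith), if_neg (by nlinarith)]
    ring
  by_cases a2 : x < (1 + α) * Real.pi
  · rw [if_neg a1, if_pos a2, if_neg (by nlinarith)]
    by_cases a3 : -(x - 2 * Real.pi) < (1 + α) * Real.pi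
    · rw [if_pos a3, key]
      field_simp
      ring
    · rw [if_neg a3]
      have : x = (1 - α) * Real.pi := by nlinarith
      rw [this]
      simp only [sub_self, zero_div, Real.cos_zero]
      field_simp
      norm_num
  · rw [if_neg a1, if_neg a2]
    by_cases a3 : -(x - 2 * Real.pi) < (1 - α) * Real.pi
    · rw [if_pos a3]
      ring
    · have : x = (1 + α) * Real.pi := by nlinarith
      rw [if_neg a3, if_pos (by nlinarith), key, this]
      have : ((1 + α) * Real.pi - (1 - α) * Real.pi) / (2 * α) = Real.pi := by
        field_simp
        ring
      rw [this, Real.cos_pi]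
      field_simp
      norm_num

/-- (Corollary: generalised raised-cosine MRA) If `lam : (0,1) → ℝ` is a nonnegative
measurable probability density, then the scaling function spectrum
`Φ(w) := √( ∫_0^1 lam(α)·P_α(w) dα )`, where `P_α` is the raised cosine spectrum with roll-off
`α`, satisfies Meyer's central condition `∑_{n ∈ ℤ} Φ(w + 2πn)² = 1/(2π)` for every `w`. -/
theorem generalised_raisedCosine_MRA
    (lam : ℝ → ℝ)
    (hlam_meas : Measurable lam)
    (hlam_nonneg : ∀ α ∈ Set.Ioo (0 : ℝ) 1, 0 ≤ lam α)
    (hlam_prob : ∫ α in Set.Ioo (0 : ℝ) 1, lam α = 1) :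
    ∀ w : ℝ,
      ∑' n : ℤ,
          (Real.sqrt (∫ α in Set.Ioo (0 : ℝ) 1, lam α * raisedCosine α (w + 2 * Real.pi * n))) ^ 2
        = 1 / (2 * Real.pi) := by
  intro w
  have hp := Real.pi_pos
  have hint : IntegrableOn lam (Set.Ioo (0 : ℝ) 1) := by
    by_contra h
    rw [integral_undef h] at hlam_prob
    norm_num at hlam_prob
  have hI : ∀ v : ℝ, IntegrableOn (fun α => lam α * raisedCosine α v) (Set.Ioo (0 : ℝ) 1) := by
    intro v
    refine Integrable.mul_bdd (c := 1 / (2 * Real.pi)) hint (rc_meas v).aestronglyMeasurable ?_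
    refine Filter.Eventually.of_forall fun α => ?_
    rw [Real.norm_of_nonneg (rc_nonneg α v)]
    exact rc_le α v
  have hsq : ∀ v : ℝ, (Real.sqrt (∫ α in Set.Ioo (0 : ℝ) 1, lam α * raisedCosine α v)) ^ 2
      = ∫ α in Set.Ioo (0 : ℝ) 1, lam α * raisedCosine α v := fun v =>
    Real.sq_sqrt (setIntegral_nonneg measurableSet_Ioo
      fun α hα => mul_nonneg (hlam_nonneg α hα) (rc_nonneg α v))
  simp only [hsq]
  obtain ⟨m, hm0, hm1⟩ : ∃ m : ℤ, 0 ≤ w + 2 * Real.pi * m ∧ w + 2 * Real.pi * m < 2 * Real.pi := by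
    refine ⟨-⌊w / (2 * Real.pi)⌋, ?_, ?_⟩
    · have h := Int.floor_le (w / (2 * Real.pi))
      rw [le_div_iff₀ (by positivity)] at h
      push_cast
      linarith
    · have h := Int.lt_floor_add_one (w / (2 * Real.pi))
      rw [div_lt_iff₀ (by positivity)] at h
      push_cast
      linarith
  have hz : ∀ n : ℤ, n ∉ ({m, m - 1} : Finset ℤ) →
      ∫ α in Set.Ioo (0 : ℝ) 1, lam α * raisedCosine α (w + 2 * Real.pi * n) = 0 := by
    intro n hn
    simp only [Finset.mem_insert, Finset.mem_singleton, not_or] at hn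
    refine setIntegral_eq_zero_of_forall_eq_zero fun α hα => ?_
    rw [rc_zero hα.1 hα.2, mul_zero]
    rcases (by omega : m + 1 ≤ n ∨ n ≤ m - 2) with h | h
    · have h' : (m : ℝ) + 1 ≤ n := by exact_mod_cast h
      refine le_trans ?_ (le_abs_self _)
      nlinarith
    · have h' : (n : ℝ) ≤ m - 2 := by exact_mod_cast h
      refine le_trans ?_ (neg_le_abs _)
      nlinarith
  rw [tsum_eq_sum (fun n hn => hz n hn), Finset.sum_pair (by omega),
    ← integral_add (hI _) (hI _)]
  have : ∀ α ∈ Set.Ioo (0 : ℝ) 1, lam α * raisedCosine α (w + 2 * Real.pi * m)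
      + lam α * raisedCosine α (w + 2 * Real.pi * (m - 1 : ℤ)) = lam α * (1 / (2 * Real.pi)) := by
    intro α hα
    rw [← mul_add, ← rc_pair hα.1 hα.2 hm0 hm1.le]
    congr 3
    push_cast
    ring
  rw [setIntegral_congr_fun measurableSet_Ioo this, integral_mul_const, hlam_prob, one_mul]
end
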